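/- Type validity: for any derivable logical typing Γ ⊢ m : A, there exists a sort s such that Γ ⊢ A : s is derivable. -/

import Mathlib

namespace TLL

/-- The two sorts of TLL: `U` (non-linear) and `L` (linear). -/
inductive Srt : Type
  | U | L
deriving DecidableEq

/-- TLL terms in de Bruijn representation: variables, sorts, the two Π-type
formers (irrelevant `pi0` and relevant `pi1`), the two λ-formers, application,
the erased constant `box`, and heap pointers `ptr`. -/
inductive Tm : Type
  | var  : Nat → Tm
  | srt  : Srt → Tm
  | pi0  : Srt → Tm → Tm → Tm
  | pi1  : Srt → Tm → Tm → Tm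
  | lam0 : Srt → Tm → Tm → Tm
  | lam1 : Srt → Tm → Tm → Tm
  | app  : Tm → Tm → Tm
  | box  : Tm
  | ptr  : Nat → Tm

def upr (ξ : Nat → Nat) : Nat → Nat
  | 0 => 0
  | n + 1 => ξ n + 1

def rename (ξ : Nat → Nat) : Tm → Tm
  | .var x => .var (ξ x)
  | .srt s => .srt s
  | .pi0 t A B => .pi0 t (rename ξ A) (rename (upr ξ) B)
  | .pi1 t A B => .pi1 t (rename ξ A) (rename (upr ξ) B)
  | .lam0 t A m => .lam0 t (rename ξ A) (rename (upr ξ) m)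
  | .lam1 t A m => .lam1 t (rename ξ A) (rename (upr ξ) m)
  | .app m n => .app (rename ξ m) (rename ξ n)
  | .box => .box
  | .ptr l => .ptr l

def up (σ : Nat → Tm) : Nat → Tm
  | 0 => .var 0
  | n + 1 => rename Nat.succ (σ n)

def subst (σ : Nat → Tm) : Tm → Tm
  | .var x => σ x
  | .srt s => .srt s
  | .pi0 t A B => .pi0 t (subst σ A) (subst (up σ) B)
  | .pi1 t A B => .pi1 t (subst σ A) (subst (up σ) B)
  | .lam0 t A m => .lam0 t (subst σ A) (subst (up σ) m)
  | .lam1 t A m => .lam1 t (subst σ A) (subst (up σ) m)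
  | .app m n => .app (subst σ m) (subst σ n)
  | .box => .box
  | .ptr l => .ptr l

/-- `subst1 n m` is `m[n/x]` for the topmost bound variable `x`. -/
def subst1 (n : Tm) (m : Tm) : Tm :=
  subst (fun i => match i with | 0 => n | i + 1 => .var i) m

/-- Logical one-step reduction `m ~> n`: full β-reduction with both β-rules,
closed under all structural subterm positions. -/
inductive LStep : Tm → Tm → Prop
  | beta0 {t A m n} : LStep (.app (.lam0 t A m) n) (subst1 n m)
  | beta1 {t A m n} : LStep (.app (.lam1 t A m) n) (subst1 n m)
  | appL {m m' n} : LStep m m' → LStep (.app m n) (.app m' n)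
  | appR {m n n'} : LStep n n' → LStep (.app m n) (.app m n')
  | pi0A {t A A' B} : LStep A A' → LStep (.pi0 t A B) (.pi0 t A' B)
  | pi0B {t A B B'} : LStep B B' → LStep (.pi0 t A B) (.pi0 t A B')
  | pi1A {t A A' B} : LStep A A' → LStep (.pi1 t A B) (.pi1 t A' B)
  | pi1B {t A B B'} : LStep B B' → LStep (.pi1 t A B) (.pi1 t A B')
  | lam0A {t A A' m} : LStep A A' → LStep (.lam0 t A m) (.lam0 t A' m)
  | lam0M {t A m m'} : LStep m m' → LStep (.lam0 t A m) (.lam0 t A m')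
  | lam1A {t A A' m} : LStep A A' → LStep (.lam1 t A m) (.lam1 t A' m)
  | lam1M {t A m m'} : LStep m m' → LStep (.lam1 t A m) (.lam1 t A m')

/-- Multi-step logical reduction. -/
abbrev LRed : Tm → Tm → Prop := Relation.ReflTransGen LStep

/-- Definitional equality `A ≃ B`: equivalence closure of logical reduction. -/
def Conv (A B : Tm) : Prop := Relation.EqvGen LStep A B

/-- Parallel logical reduction `m ⇒ n`. -/
inductive PStep : Tm → Tm → Prop
  | var {x} : PStep (.var x) (.var x)
  | srt {s} : PStep (.srt s) (.srt s)
  | box : PStep .box .box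
  | ptr {l} : PStep (.ptr l) (.ptr l)
  | pi0 {t A A' B B'} : PStep A A' → PStep B B' → PStep (.pi0 t A B) (.pi0 t A' B')
  | pi1 {t A A' B B'} : PStep A A' → PStep B B' → PStep (.pi1 t A B) (.pi1 t A' B')
  | lam0 {t A A' m m'} : PStep A A' → PStep m m' → PStep (.lam0 t A m) (.lam0 t A' m')
  | lam1 {t A A' m m'} : PStep A A' → PStep m m' → PStep (.lam1 t A m) (.lam1 t A' m')
  | app {m m' n n'} : PStep m m' → PStep n n' → PStep (.app m n) (.app m' n')
  | beta0 {t A m m' n n'} : PStep m m' → PStep n n' →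
      PStep (.app (.lam0 t A m) n) (subst1 n' m')
  | beta1 {t A m m' n n'} : PStep m m' → PStep n n' →
      PStep (.app (.lam1 t A m) n) (subst1 n' m')

/-- Logical contexts: lists of types (de Bruijn). -/
abbrev Ctx := List Tm

/-- `Has Γ x A`: variable `x` has type `A` in logical context `Γ`
(with the appropriate de Bruijn shifts). -/
inductive Has : Ctx → Nat → Tm → Prop
  | zero {Γ A} : Has (A :: Γ) 0 (rename Nat.succ A)
  | succ {Γ x A B} : Has Γ x A → Has (B :: Γ) (x + 1) (rename Nat.succ A)

mutual
/-- Well-formed logical contexts. -/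
inductive LWf : Ctx → Prop
  | nil : LWf []
  | cons {Γ A s} : LWf Γ → LTyped Γ A (.srt s) → LWf (A :: Γ)

/-- The logical typing judgment `Γ ⊢ m : A`. -/
inductive LTyped : Ctx → Tm → Tm → Prop
  | srt {Γ} (s : Srt) : LWf Γ → LTyped Γ (.srt s) (.srt .U)
  | var {Γ x A} : LWf Γ → Has Γ x A → LTyped Γ (.var x) A
  | pi0 {Γ A B s r} (t : Srt) :
      LTyped Γ A (.srt s) → LTyped (A :: Γ) B (.srt r) →
      LTyped Γ (.pi0 t A B) (.srt t)
  | pi1 {Γ A B s r} (t : Srt) :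
      LTyped Γ A (.srt s) → LTyped (A :: Γ) B (.srt r) →
      LTyped Γ (.pi1 t A B) (.srt t)
  | lam0 {Γ A B m} (t : Srt) :
      LTyped (A :: Γ) m B → LTyped Γ (.lam0 t A m) (.pi0 t A B)
  | lam1 {Γ A B m} (t : Srt) :
      LTyped (A :: Γ) m B → LTyped Γ (.lam1 t A m) (.pi1 t A B)
  | app0 {Γ m n A B t} :
      LTyped Γ m (.pi0 t A B) → LTyped Γ n A → LTyped Γ (.app m n) (subst1 n B)
  | app1 {Γ m n A B t} :
      LTyped Γ m (.pi1 t A B) → LTyped Γ n A → LTyped Γ (.app m n) (subst1 n B)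
  | conv {Γ m A B s} :
      LTyped Γ m A → LTyped Γ B (.srt s) → Conv A B → LTyped Γ m B
end

/-- Program context entries: either absent, or a sort-annotated type. -/
abbrev Entry := Option (Srt × Tm)

/-- Program contexts, positionally aligned with the logical context. -/
abbrev PCtx := List Entry

/-- The context constraint `Δ ▷ s`. -/
inductive Restr : PCtx → Srt → Prop
  | nil {s} : Restr [] s
  | skip {Δ s} : Restr Δ s → Restr ((none : Entry) :: Δ) s
  | u {Δ A} : Restr Δ .U → Restr (some (.U, A) :: Δ) .U
  | l {Δ s A} : Restr Δ .L → Restr (some (s, A) :: Δ) .L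

/-- Context merge `Δ₁ ∪̇ Δ₂ = Δ`: contraction on shared `U` entries,
`L` entries occur on exactly one side. -/
inductive Merge : PCtx → PCtx → PCtx → Prop
  | nil : Merge [] [] []
  | contra {Δ₁ Δ₂ Δ A} : Merge Δ₁ Δ₂ Δ →
      Merge (some (.U, A) :: Δ₁) (some (.U, A) :: Δ₂) (some (.U, A) :: Δ)
  | left {Δ₁ Δ₂ Δ A} : Merge Δ₁ Δ₂ Δ →
      Merge (some (.L, A) :: Δ₁) ((none : Entry) :: Δ₂) (some (.L, A) :: Δ)
  | right {Δ₁ Δ₂ Δ A} : Merge Δ₁ Δ₂ Δ →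
      Merge ((none : Entry) :: Δ₁) (some (.L, A) :: Δ₂) (some (.L, A) :: Δ)
  | skip {Δ₁ Δ₂ Δ} : Merge Δ₁ Δ₂ Δ →
      Merge ((none : Entry) :: Δ₁) ((none : Entry) :: Δ₂) ((none : Entry) :: Δ)

/-- `PHas Δ x s A`: the entry `x :s A` occurs in `Δ` and the rest of `Δ`
satisfies `▷ U` (so no linear entry is discarded). -/
inductive PHas : PCtx → Nat → Srt → Tm → Prop
  | zero {Δ s A} : Restr Δ .U → PHas (some (s, A) :: Δ) 0 s (rename Nat.succ A)
  | succN {Δ x s A} : PHas Δ x s A → PHas ((none : Entry) :: Δ) (x + 1) s (rename Nat.succ A)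
  | succU {Δ x s A B} : PHas Δ x s A → PHas (some (.U, B) :: Δ) (x + 1) s (rename Nat.succ A)

/-- Well-formed pairs of logical and program contexts `Γ ; Δ ⊢`. -/
inductive PWf : Ctx → PCtx → Prop
  | nil : PWf [] []
  | cons {Γ Δ A s} : PWf Γ Δ → LTyped Γ A (.srt s) → PWf (A :: Γ) (some (s, A) :: Δ)
  | consN {Γ Δ A s} : PWf Γ Δ → LTyped Γ A (.srt s) → PWf (A :: Γ) ((none : Entry) :: Δ)

/-- The program typing judgment `Γ ; Δ ⊢ m : A`. -/
inductive PTyped : Ctx → PCtx → Tm → Tm → Prop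
  | var {Γ Δ x s A} : PWf Γ Δ → PHas Δ x s A → PTyped Γ Δ (.var x) A
  | lam0 {Γ Δ A B m} (t : Srt) :
      PTyped (A :: Γ) ((none : Entry) :: Δ) m B → Restr Δ t →
      PTyped Γ Δ (.lam0 t A m) (.pi0 t A B)
  | lam1 {Γ Δ A B m s} (t : Srt) :
      PTyped (A :: Γ) (some (s, A) :: Δ) m B → Restr Δ t →
      PTyped Γ Δ (.lam1 t A m) (.pi1 t A B)
  | app0 {Γ Δ m n A B t} :
      PTyped Γ Δ m (.pi0 t A B) → LTyped Γ n A →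
      PTyped Γ Δ (.app m n) (subst1 n B)
  | app1 {Γ Δ₁ Δ₂ Δ m n A B t} :
      PTyped Γ Δ₁ m (.pi1 t A B) → PTyped Γ Δ₂ n A → Merge Δ₁ Δ₂ Δ →
      PTyped Γ Δ (.app m n) (subst1 n B)
  | conv {Γ Δ m A B s} :
      PTyped Γ Δ m A → LTyped Γ B (.srt s) → Conv A B →
      PTyped Γ Δ m B

/-- Program values. -/
inductive Value : Tm → Prop
  | var {x} : Value (.var x)
  | lam0 {t A m} : Value (.lam0 t A m)
  | lam1 {t A m} : Value (.lam1 t A m)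

/-- Program (call-by-value) one-step reduction `m ~~> n`. -/
inductive CStep : Tm → Tm → Prop
  | appL {m m' n} : CStep m m' → CStep (.app m n) (.app m' n)
  | appR {m n n'} : CStep n n' → CStep (.app m n) (.app m n')
  | beta0 {t A m n} : CStep (.app (.lam0 t A m) n) (subst1 n m)
  | beta1 {t A m v} : Value v → CStep (.app (.lam1 t A m) v) (subst1 v m)

/-- The erasure judgment `Γ ; Δ ⊢ m ~ m' : A`. -/
inductive Erase : Ctx → PCtx → Tm → Tm → Tm → Prop
  | var {Γ Δ x s A} : PWf Γ Δ → PHas Δ x s A → Erase Γ Δ (.var x) (.var x) A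
  | lam0 {Γ Δ A B m m'} (t : Srt) :
      Erase (A :: Γ) ((none : Entry) :: Δ) m m' B → Restr Δ t →
      Erase Γ Δ (.lam0 t A m) (.lam0 t .box m') (.pi0 t A B)
  | lam1 {Γ Δ A B m m' s} (t : Srt) :
      Erase (A :: Γ) (some (s, A) :: Δ) m m' B → Restr Δ t →
      Erase Γ Δ (.lam1 t A m) (.lam1 t .box m') (.pi1 t A B)
  | app0 {Γ Δ m m' n A B t} :
      Erase Γ Δ m m' (.pi0 t A B) → LTyped Γ n A →
      Erase Γ Δ (.app m n) (.app m' .box) (subst1 n B)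
  | app1 {Γ Δ₁ Δ₂ Δ m m' n n' A B t} :
      Erase Γ Δ₁ m m' (.pi1 t A B) → Erase Γ Δ₂ n n' A → Merge Δ₁ Δ₂ Δ →
      Erase Γ Δ (.app m n) (.app m' n') (subst1 n B)
  | conv {Γ Δ m m' A B s} :
      Erase Γ Δ m m' A → LTyped Γ B (.srt s) → Conv A B →
      Erase Γ Δ m m' B

/-- Heaps: finite maps from locations to sort-annotated values. -/
abbrev Heap := Nat → Option (Srt × Tm)

/-- Heap lookup `Lookup H₁ l v H₂`: non-linear cells persist, linear cells
are deallocated. -/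
inductive Lookup : Heap → Nat → Tm → Heap → Prop
  | u {H l v} : H l = some (.U, v) → Lookup H l v H
  | l {H l v} : H l = some (.L, v) → Lookup H l v (Function.update H l none)

/-- Heap merge `H₁ ∪̇ H₂ = H`. -/
def HMerge (H₁ H₂ H : Heap) : Prop := ∀ l,
  (H₁ l = none ∧ H₂ l = none ∧ H l = none) ∨
  (∃ v, H₁ l = some (.U, v) ∧ H₂ l = some (.U, v) ∧ H l = some (.U, v)) ∨
  (∃ v, H₁ l = some (.L, v) ∧ H₂ l = none ∧ H l = some (.L, v)) ∨
  (∃ v, H₁ l = none ∧ H₂ l = some (.L, v) ∧ H l = some (.L, v))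

/-- The heap constraint `H ▷ s`. -/
def HRestr (H : Heap) : Srt → Prop
  | .U => ∀ l s v, H l = some (s, v) → s = Srt.U
  | .L => True

/-- Heap reduction `H ; m ~~> H' ; m'`. -/
inductive HStep : Heap → Tm → Heap → Tm → Prop
  | alloc0 {H l t m} : H l = none →
      HStep H (.lam0 t .box m) (Function.update H l (some (t, .lam0 t .box m))) (.ptr l)
  | alloc1 {H l t m} : H l = none →
      HStep H (.lam1 t .box m) (Function.update H l (some (t, .lam1 t .box m))) (.ptr l)
  | appL {H H' m m' n} : HStep H m H' m' → HStep H (.app m n) H' (.app m' n)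
  | appR {H H' m n n'} : HStep H n H' n' → HStep H (.app m n) H' (.app m n')
  | beta0 {H H' l t m n} : Lookup H l (.lam0 t .box m) H' →
      HStep H (.app (.ptr l) n) H' (subst1 .box m)
  | beta1 {H H' l₁ l₂ t m} : Lookup H l₁ (.lam1 t .box m) H' →
      HStep H (.app (.ptr l₁) (.ptr l₂)) H' (subst1 (.ptr l₂) m)

/-- Pointer resolution `H ; m ~ n`. -/
inductive Resolve : Heap → Tm → Tm → Prop
  | var {H x} : HRestr H .U → Resolve H (.var x) (.var x)
  | lam0 {H t m' m} : HRestr H t → Resolve H m' m →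
      Resolve H (.lam0 t .box m') (.lam0 t .box m)
  | lam1 {H t m' m} : HRestr H t → Resolve H m' m →
      Resolve H (.lam1 t .box m') (.lam1 t .box m)
  | app0 {H m' m} : Resolve H m' m → Resolve H (.app m' .box) (.app m .box)
  | app1 {H₁ H₂ H m' m n' n} : HMerge H₁ H₂ H →
      Resolve H₁ m' m → Resolve H₂ n' n → Resolve H (.app m' n') (.app m n)
  | ptr {H H' l v' v} : Lookup H l v' H' → Resolve H' v' v → Resolve H (.ptr l) v

/-- `ClosedUnder k m`: all free de Bruijn variables of `m` are `< k`. -/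
def ClosedUnder : Nat → Tm → Prop
  | k, .var x => x < k
  | _, .srt _ => True
  | k, .pi0 _ A B => ClosedUnder k A ∧ ClosedUnder (k + 1) B
  | k, .pi1 _ A B => ClosedUnder k A ∧ ClosedUnder (k + 1) B
  | k, .lam0 _ A m => ClosedUnder k A ∧ ClosedUnder (k + 1) m
  | k, .lam1 _ A m => ClosedUnder k A ∧ ClosedUnder (k + 1) m
  | k, .app m n => ClosedUnder k m ∧ ClosedUnder k n
  | _, .box => True
  | _, .ptr _ => True

/-- WR-heaps: heaps plausibly produced by heap reduction. -/
inductive WrHeap : Heap → Prop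
  | nil : WrHeap (fun _ => none)
  | lam0 {H l t m} : ClosedUnder 1 m → WrHeap H → H l = none →
      WrHeap (Function.update H l (some (t, .lam0 t .box m)))
  | lam1 {H l t m} : ClosedUnder 1 m → WrHeap H → H l = none →
      WrHeap (Function.update H l (some (t, .lam1 t .box m)))

/-- Well-resolved `H ⊢ a ~ b ~ c : A`. -/
def WellResolved (H : Heap) (a b c A : Tm) : Prop :=
  Erase [] [] a b A ∧ Resolve H c b


theorem rename_eq_subst (ξ : Nat → Nat) (m : Tm) :
    rename ξ m = subst (fun x => .var (ξ x)) m := by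
  have up_var (ξ : Nat → Nat) : up (fun x => .var (ξ x)) = fun x => .var (upr ξ x) := by
    funext x; cases x <;> rfl
  induction m generalizing ξ <;> simp_all [rename, subst]

theorem subst_rename (σ : Nat → Tm) (ξ : Nat → Nat) (m : Tm) :
    subst σ (rename ξ m) = subst (fun x => σ (ξ x)) m := by
  have up_upr (σ : Nat → Tm) (ξ : Nat → Nat) :
      (fun x => up σ (upr ξ x)) = up (fun x => σ (ξ x)) := by
    funext x; cases x <;> rfl
  induction m generalizing σ ξ <;> simp_all [rename, subst]

theorem rename_rename (ξ ζ : Nat → Nat) (m : Tm) :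
    rename ξ (rename ζ m) = rename (fun x => ξ (ζ x)) m := by
  rw [rename_eq_subst ξ, subst_rename, rename_eq_subst]

theorem rename_subst (ξ : Nat → Nat) (σ : Nat → Tm) (m : Tm) :
    rename ξ (subst σ m) = subst (fun x => rename ξ (σ x)) m := by
  have upr_up (ξ : Nat → Nat) (σ : Nat → Tm) :
      (fun x => rename (upr ξ) (up σ x)) = up (fun x => rename ξ (σ x)) := by
    funext x
    cases x with
    | zero => rfl
    | succ x => simp only [up, rename_rename]; rfl
  induction m generalizing ξ σ <;> simp_all [rename, subst]

theorem subst_up_rename_succ (σ : Nat → Tm) (m : Tm) :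
    subst (up σ) (rename Nat.succ m) = rename Nat.succ (subst σ m) := by
  rw [subst_rename, rename_subst]; rfl

theorem rename_upr_rename_succ (ξ : Nat → Nat) (m : Tm) :
    rename (upr ξ) (rename Nat.succ m) = rename Nat.succ (rename ξ m) := by
  rw [rename_rename, rename_rename]; rfl

theorem subst_subst (σ τ : Nat → Tm) (m : Tm) :
    subst σ (subst τ m) = subst (fun x => subst σ (τ x)) m := by
  have up_comp (σ τ : Nat → Tm) :
      (fun x => subst (up σ) (up τ x)) = up (fun x => subst σ (τ x)) := by
    funext x
    cases x with
    | zero => rfl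
    | succ x => exact subst_up_rename_succ σ (τ x)
  induction m generalizing σ τ <;> simp_all [subst]

theorem subst_var (m : Tm) : subst .var m = m := by
  have up_var : up .var = .var := by
    funext x; cases x <;> rfl
  induction m <;> simp_all [subst]

theorem subst1_rename_succ (n m : Tm) : subst1 n (rename Nat.succ m) = m := by
  rw [subst1, subst_rename]; exact subst_var m

theorem subst_subst1 (σ : Nat → Tm) (n m : Tm) :
    subst σ (subst1 n m) = subst1 (subst σ n) (subst (up σ) m) := by
  simp only [subst1, subst_subst]
  congr 1
  funext x
  cases x with
  | zero => rfl
  | succ x => exact (subst1_rename_succ (subst σ n) (σ x)).symm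

theorem rename_subst1 (ξ : Nat → Nat) (n m : Tm) :
    rename ξ (subst1 n m) = subst1 (rename ξ n) (rename (upr ξ) m) := by
  simp only [subst1, rename_subst, subst_rename]
  congr 1
  funext x; cases x <;> rfl

theorem LStep.subst {m n : Tm} (h : LStep m n) (σ : Nat → Tm) :
    LStep (TLL.subst σ m) (TLL.subst σ n) := by
  induction h generalizing σ with
  | beta0 => rw [subst_subst1]; exact .beta0
  | beta1 => rw [subst_subst1]; exact .beta1
  | appL _ ih => exact .appL (ih σ)
  | appR _ ih => exact .appR (ih σ)
  | pi0A _ ih => exact .pi0A (ih σ)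
  | pi0B _ ih => exact .pi0B (ih (up σ))
  | pi1A _ ih => exact .pi1A (ih σ)
  | pi1B _ ih => exact .pi1B (ih (up σ))
  | lam0A _ ih => exact .lam0A (ih σ)
  | lam0M _ ih => exact .lam0M (ih (up σ))
  | lam1A _ ih => exact .lam1A (ih σ)
  | lam1M _ ih => exact .lam1M (ih (up σ))

theorem Conv.subst {A B : Tm} (h : Conv A B) (σ : Nat → Tm) :
    Conv (TLL.subst σ A) (TLL.subst σ B) := by
  induction h with
  | rel _ _ h => exact .rel _ _ (h.subst σ)
  | refl => exact .refl _
  | symm _ _ _ ih => exact .symm _ _ ih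
  | trans _ _ _ _ _ ih₁ ih₂ => exact .trans _ _ _ ih₁ ih₂

theorem Conv.rename {A B : Tm} (h : Conv A B) (ξ : Nat → Nat) :
    Conv (TLL.rename ξ A) (TLL.rename ξ B) := by
  simpa only [rename_eq_subst] using h.subst _

/-- Induction on typing derivations in which the λ-cases also provide a derivation for the
domain (found inside the well-formedness of the extended context), with its own hypothesis. -/
theorem LTyped.induction_domain {P : ∀ Γ m A, LTyped Γ m A → Prop}
    (srt : ∀ {Γ} s (hΓ : LWf Γ), P Γ (.srt s) (.srt .U) (.srt s hΓ))
    (var : ∀ {Γ x A} (hΓ : LWf Γ) (hx : Has Γ x A), P Γ (.var x) A (.var hΓ hx))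
    (pi0 : ∀ {Γ A B s r} t (hA : LTyped Γ A (.srt s)) (hB : LTyped (A :: Γ) B (.srt r)),
      P Γ A (.srt s) hA → P (A :: Γ) B (.srt r) hB → P Γ (.pi0 t A B) (.srt t) (.pi0 t hA hB))
    (pi1 : ∀ {Γ A B s r} t (hA : LTyped Γ A (.srt s)) (hB : LTyped (A :: Γ) B (.srt r)),
      P Γ A (.srt s) hA → P (A :: Γ) B (.srt r) hB → P Γ (.pi1 t A B) (.srt t) (.pi1 t hA hB))
    (lam0 : ∀ {Γ A B m s} t (hA : LTyped Γ A (.srt s)) (hm : LTyped (A :: Γ) m B),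
      P Γ A (.srt s) hA → P (A :: Γ) m B hm → P Γ (.lam0 t A m) (.pi0 t A B) (.lam0 t hm))
    (lam1 : ∀ {Γ A B m s} t (hA : LTyped Γ A (.srt s)) (hm : LTyped (A :: Γ) m B),
      P Γ A (.srt s) hA → P (A :: Γ) m B hm → P Γ (.lam1 t A m) (.pi1 t A B) (.lam1 t hm))
    (app0 : ∀ {Γ m n A B t} (hm : LTyped Γ m (.pi0 t A B)) (hn : LTyped Γ n A),
      P Γ m (.pi0 t A B) hm → P Γ n A hn → P Γ (.app m n) (subst1 n B) (.app0 hm hn))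
    (app1 : ∀ {Γ m n A B t} (hm : LTyped Γ m (.pi1 t A B)) (hn : LTyped Γ n A),
      P Γ m (.pi1 t A B) hm → P Γ n A hn → P Γ (.app m n) (subst1 n B) (.app1 hm hn))
    (conv : ∀ {Γ m A B s} (hm : LTyped Γ m A) (hB : LTyped Γ B (.srt s)) (hAB : Conv A B),
      P Γ m A hm → P Γ B (.srt s) hB → P Γ m B (.conv hm hB hAB))
    {Γ : Ctx} {m A : Tm} (h : LTyped Γ m A) : P Γ m A h := by
  let W (Γ : Ctx) : Prop :=
    ∀ A Γ', A :: Γ' <:+ Γ → ∃ s, ∃ hA : LTyped Γ' A (.srt s), P Γ' A (.srt s) hA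
  have W_tail {A Γ} (h : W (A :: Γ)) : W Γ :=
    fun B Γ' hs => h B Γ' (hs.trans (List.suffix_cons A Γ))
  refine (LTyped.rec (motive_1 := fun Γ _ => W Γ) (motive_2 := fun Γ m A h => W Γ ∧ P Γ m A h)
    ?_ ?_ ?_ ?_ ?_ ?_ ?_ ?_ ?_ ?_ ?_ h).2
  · intro A Γ' hs
    simp at hs
  · intro Γ A s _ hA ihΓ ihA B Γ' hs
    rcases List.suffix_cons_iff.1 hs with heq | hs
    · obtain ⟨rfl, rfl⟩ := List.cons.inj heq
      exact ⟨s, hA, ihA.2⟩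
    · exact ihΓ B Γ' hs
  · exact fun s hΓ ihΓ => ⟨ihΓ, srt s hΓ⟩
  · exact fun hΓ hx ihΓ => ⟨ihΓ, var hΓ hx⟩
  · exact fun t hA hB ihA ihB => ⟨ihA.1, pi0 t hA hB ihA.2 ihB.2⟩
  · exact fun t hA hB ihA ihB => ⟨ihA.1, pi1 t hA hB ihA.2 ihB.2⟩
  · intro Γ A B m t hm ihm
    obtain ⟨s, hA, ihA⟩ := ihm.1 A Γ (List.suffix_refl _)
    exact ⟨W_tail ihm.1, lam0 t hA hm ihA ihm.2⟩
  · intro Γ A B m t hm ihm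
    obtain ⟨s, hA, ihA⟩ := ihm.1 A Γ (List.suffix_refl _)
    exact ⟨W_tail ihm.1, lam1 t hA hm ihA ihm.2⟩
  · exact fun hm hn ihm ihn => ⟨ihm.1, app0 hm hn ihm.2 ihn.2⟩
  · exact fun hm hn ihm ihn => ⟨ihm.1, app1 hm hn ihm.2 ihn.2⟩
  · exact fun hm hB hAB ihm ihB => ⟨ihm.1, conv hm hB hAB ihm.2 ihB.2⟩

theorem LTyped.wf {Γ : Ctx} {m A : Tm} (h : LTyped Γ m A) : LWf Γ := by
  induction h using LTyped.induction_domain with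
  | srt _ hΓ => exact hΓ
  | var hΓ _ => exact hΓ
  | pi0 _ _ _ ih _ => exact ih
  | pi1 _ _ _ ih _ => exact ih
  | lam0 _ _ _ ih _ => exact ih
  | lam1 _ _ _ ih _ => exact ih
  | app0 _ _ ih _ => exact ih
  | app1 _ _ ih _ => exact ih
  | conv _ _ _ ih _ => exact ih

/-- `ξ` is a renaming from `Γ` to `Δ`. -/
def RenWt (ξ : Nat → Nat) (Γ Δ : Ctx) : Prop :=
  ∀ x A, Has Γ x A → Has Δ (ξ x) (rename ξ A)

theorem RenWt.upr {ξ : Nat → Nat} {Γ Δ : Ctx} (h : RenWt ξ Γ Δ) (A : Tm) :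
    RenWt (upr ξ) (A :: Γ) (rename ξ A :: Δ) := by
  rintro _ _ (_ | hx) <;> rw [rename_upr_rename_succ]
  · exact .zero
  · exact .succ (h _ _ hx)

theorem LTyped.rename {Γ Δ : Ctx} {m A : Tm} {ξ : Nat → Nat} (h : LTyped Γ m A)
    (hΔ : LWf Δ) (hξ : RenWt ξ Γ Δ) : LTyped Δ (rename ξ m) (rename ξ A) := by
  induction h using LTyped.induction_domain generalizing Δ ξ with
  | srt s _ => exact .srt s hΔ
  | var _ hx => exact .var hΔ (hξ _ _ hx)
  | pi0 t _ _ ihA ihB =>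
    have hA := ihA hΔ hξ
    exact .pi0 t hA (ihB (.cons hΔ hA) (hξ.upr _))
  | pi1 t _ _ ihA ihB =>
    have hA := ihA hΔ hξ
    exact .pi1 t hA (ihB (.cons hΔ hA) (hξ.upr _))
  | lam0 t _ _ ihA ihm => exact .lam0 t (ihm (.cons hΔ (ihA hΔ hξ)) (hξ.upr _))
  | lam1 t _ _ ihA ihm => exact .lam1 t (ihm (.cons hΔ (ihA hΔ hξ)) (hξ.upr _))
  | app0 _ _ ihm ihn => rw [rename_subst1]; exact .app0 (ihm hΔ hξ) (ihn hΔ hξ)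
  | app1 _ _ ihm ihn => rw [rename_subst1]; exact .app1 (ihm hΔ hξ) (ihn hΔ hξ)
  | conv _ _ hAB ihm ihB => exact .conv (ihm hΔ hξ) (ihB hΔ hξ) (hAB.rename ξ)

theorem LTyped.weaken {Γ : Ctx} {m A B : Tm} (h : LTyped Γ m A) (hΓ : LWf (B :: Γ)) :
    LTyped (B :: Γ) (TLL.rename Nat.succ m) (TLL.rename Nat.succ A) :=
  h.rename hΓ fun _ _ hx => .succ hx

/-- `σ` is a well-typed substitution from `Γ` to `Δ`. -/
def SubstWt (σ : Nat → Tm) (Γ Δ : Ctx) : Prop :=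
  ∀ x A, Has Γ x A → LTyped Δ (σ x) (subst σ A)

theorem SubstWt.up {σ : Nat → Tm} {Γ Δ : Ctx} {A : Tm} (h : SubstWt σ Γ Δ)
    (hΔ : LWf (subst σ A :: Δ)) : SubstWt (up σ) (A :: Γ) (subst σ A :: Δ) := by
  rintro _ _ (_ | hx) <;> rw [subst_up_rename_succ]
  · exact .var hΔ .zero
  · exact (h _ _ hx).weaken hΔ

theorem LTyped.subst {Γ Δ : Ctx} {m A : Tm} {σ : Nat → Tm} (h : LTyped Γ m A)
    (hΔ : LWf Δ) (hσ : SubstWt σ Γ Δ) : LTyped Δ (subst σ m) (subst σ A) := by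
  induction h using LTyped.induction_domain generalizing Δ σ with
  | srt s _ => exact .srt s hΔ
  | var _ hx => exact hσ _ _ hx
  | pi0 t _ _ ihA ihB =>
    have hA := ihA hΔ hσ
    exact .pi0 t hA (ihB (.cons hΔ hA) (hσ.up (.cons hΔ hA)))
  | pi1 t _ _ ihA ihB =>
    have hA := ihA hΔ hσ
    exact .pi1 t hA (ihB (.cons hΔ hA) (hσ.up (.cons hΔ hA)))
  | lam0 t _ _ ihA ihm =>
    have hΔA := LWf.cons hΔ (ihA hΔ hσ)
    exact .lam0 t (ihm hΔA (hσ.up hΔA))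
  | lam1 t _ _ ihA ihm =>
    have hΔA := LWf.cons hΔ (ihA hΔ hσ)
    exact .lam1 t (ihm hΔA (hσ.up hΔA))
  | app0 _ _ ihm ihn => rw [subst_subst1]; exact .app0 (ihm hΔ hσ) (ihn hΔ hσ)
  | app1 _ _ ihm ihn => rw [subst_subst1]; exact .app1 (ihm hΔ hσ) (ihn hΔ hσ)
  | conv _ _ hAB ihm ihB => exact .conv (ihm hΔ hσ) (ihB hΔ hσ) (hAB.subst σ)

theorem LTyped.subst1 {Γ : Ctx} {m n A B : Tm} (hm : LTyped (A :: Γ) m B)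
    (hn : LTyped Γ n A) : LTyped Γ (subst1 n m) (subst1 n B) := by
  refine hm.subst hn.wf fun x C hx => ?_
  cases hx with
  | zero =>
    change LTyped Γ n (TLL.subst1 n _)
    rwa [subst1_rename_succ]
  | succ hx =>
    change LTyped Γ (.var _) (TLL.subst1 n _)
    rw [subst1_rename_succ]
    exact .var hn.wf hx

theorem Has.exists_sort {Γ : Ctx} {x : Nat} {A : Tm} (h : Has Γ x A) (hΓ : LWf Γ) :
    ∃ s, LTyped Γ A (.srt s) := by
  induction h with
  | zero =>
    cases hΓ with
    | cons hΓ hA => exact ⟨_, hA.weaken (.cons hΓ hA)⟩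
  | succ _ ih =>
    cases hΓ with
    | cons hΓ hB =>
      obtain ⟨s, hA⟩ := ih hΓ
      exact ⟨s, hA.weaken (.cons hΓ hB)⟩

theorem LTyped.pi0_codomain {Γ : Ctx} {t : Srt} {A B C : Tm}
    (h : LTyped Γ (.pi0 t A B) C) : ∃ r, LTyped (A :: Γ) B (.srt r) := by
  generalize hm : Tm.pi0 t A B = m at h
  induction h using LTyped.rec (motive_1 := fun _ _ => True) with
  | pi0 _ _ hB => cases hm; exact ⟨_, hB⟩
  | conv _ _ _ ih _ => exact ih hm
  | nil => trivial
  | cons => trivial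
  | _ => cases hm

theorem LTyped.pi1_codomain {Γ : Ctx} {t : Srt} {A B C : Tm}
    (h : LTyped Γ (.pi1 t A B) C) : ∃ r, LTyped (A :: Γ) B (.srt r) := by
  generalize hm : Tm.pi1 t A B = m at h
  induction h using LTyped.rec (motive_1 := fun _ _ => True) with
  | pi1 _ _ hB => cases hm; exact ⟨_, hB⟩
  | conv _ _ _ ih _ => exact ih hm
  | nil => trivial
  | cons => trivial
  | _ => cases hm

/-- Type validity. -/
theorem type_validity {Γ : Ctx} {m A : Tm}
    (h : LTyped Γ m A) :
    ∃ s : Srt, LTyped Γ A (.srt s) := by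
  induction h using LTyped.rec (motive_1 := fun _ _ => True) with
  | nil => trivial
  | cons => trivial
  | srt _ hΓ => exact ⟨.U, .srt .U hΓ⟩
  | var hΓ hx => exact hx.exists_sort hΓ
  | pi0 t hA => exact ⟨.U, .srt t hA.wf⟩
  | pi1 t hA => exact ⟨.U, .srt t hA.wf⟩
  | lam0 t hm ih =>
    obtain ⟨r, hB⟩ := ih
    cases hm.wf with
    | cons _ hA => exact ⟨t, .pi0 t hA hB⟩
  | lam1 t hm ih =>
    obtain ⟨r, hB⟩ := ih
    cases hm.wf with
    | cons _ hA => exact ⟨t, .pi1 t hA hB⟩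
  | app0 _ hn ih _ =>
    obtain ⟨s, hPi⟩ := ih
    obtain ⟨r, hB⟩ := hPi.pi0_codomain
    exact ⟨r, hB.subst1 hn⟩
  | app1 _ hn ih _ =>
    obtain ⟨s, hPi⟩ := ih
    obtain ⟨r, hB⟩ := hPi.pi1_codomain
    exact ⟨r, hB.subst1 hn⟩
  | conv _ hB => exact ⟨_, hB⟩
end TLL
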